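/- arXiv:1509.02643 — 2 statements merged into one kernel-verified Lean document; each statement's English description precedes it below -/
import Mathlib

section
/- Let A be a C*-algebra and let I be a closed two-sided ideal of A. Then the restriction map ρ ↦ ρ|_I is a bijection from the set of pure states of A that do not vanish identically on I onto the set of pure states of I, and both this map and its inverse are continuous for the weak* topologies (of the duals of A and of I respectively). -/
open scoped ComplexOrder InnerProductSpace

noncomputable section

variable (A : Type*) [NonUnitalNormedRing A] [NormedSpace ℂ A] [StarRing A]

/-- A state on a C*-algebra: a continuous linear functional which is positive
(`φ (a* a) ≥ 0` in the complex order) and of norm one. -/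
def IsState (φ : A →L[ℂ] ℂ) : Prop :=
  (∀ a : A, 0 ≤ φ (star a * a)) ∧ ‖φ‖ = 1

/-- A pure state: an extreme point of the set of states. -/
def IsPureState (φ : A →L[ℂ] ℂ) : Prop :=
  φ ∈ Set.extremePoints ℝ {ψ : A →L[ℂ] ℂ | IsState A ψ}

section Hereditary

variable [PartialOrder A] [StarOrderedRing A]

/-- A hereditary C*-subalgebra: a closed *-subalgebra `B` such that
`0 ≤ a ≤ b` with `b ∈ B` implies `a ∈ B`. -/
def IsHereditary (B : NonUnitalStarSubalgebra ℂ A) : Prop :=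
  IsClosed (B : Set A) ∧ ∀ a : A, ∀ b ∈ B, 0 ≤ a → a ≤ b → a ∈ B

end Hereditary

variable {H : Type*} [NormedAddCommGroup H] [InnerProductSpace ℂ H] [CompleteSpace H]

/-- Irreducibility of a representation: the space is nonzero and the only closed
invariant subspaces are `⊥` and `⊤`. -/
def IsIrredRep (π : A →⋆ₙₐ[ℂ] (H →L[ℂ] H)) : Prop :=
  (∃ x : H, x ≠ 0) ∧
  ∀ K : Submodule ℂ H, IsClosed (K : Set H) → (∀ a : A, ∀ x ∈ K, π a x ∈ K) → K = ⊥ ∨ K = ⊤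

/-- `K_π(S)`: the closed linear span of `{π b x : b ∈ S, x ∈ H}`. -/
def repSpan (π : A →⋆ₙₐ[ℂ] (H →L[ℂ] H)) (S : Set A) : Submodule ℂ H :=
  (Submodule.span ℂ {y : H | ∃ b ∈ S, ∃ x : H, y = π b x}).topologicalClosure

/-- A closed two-sided ideal: a norm-closed subspace `I` with `AI ⊆ I` and `IA ⊆ I`. -/
def IsClosedTwoSidedIdeal {A : Type*} [NonUnitalNormedRing A] [NormedSpace ℂ A]
    (I : Submodule ℂ A) : Prop :=
  IsClosed (I : Set A) ∧ (∀ a x : A, x ∈ I → a * x ∈ I) ∧ ∀ a x : A, x ∈ I → x * a ∈ I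

/-- A state of a two-sided ideal `I`, regarded as a C*-algebra in its own right:
positivity is expressed on the elements of `I` of the form `x* x` (which lie in `I`
since `I` is an ideal). -/
def IsStateOfIdeal {A : Type*} [NonUnitalNormedRing A] [NormedSpace ℂ A] [StarRing A]
    (I : Submodule ℂ A) (φ : ↥I →L[ℂ] ℂ) : Prop :=
  (∀ x y : ↥I, (y : A) = star (x : A) * (x : A) → 0 ≤ φ y) ∧ ‖φ‖ = 1

/-- A pure state of a two-sided ideal `I`: an extreme point of its set of states. -/
def IsPureStateOfIdeal {A : Type*} [NonUnitalNormedRing A] [NormedSpace ℂ A] [StarRing A]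
    (I : Submodule ℂ A) (φ : ↥I →L[ℂ] ℂ) : Prop :=
  φ ∈ Set.extremePoints ℝ {ψ : ↥I →L[ℂ] ℂ | IsStateOfIdeal I ψ}

section PositiveFunctionals

theorem norm_sq_apply_star_mul_le {R : Type*} [NonUnitalRing R] [StarRing R] [Module ℂ R]
    [IsScalarTower ℂ R R] [SMulCommClass ℂ R R] [StarModule ℂ R] (I : Submodule ℂ R)
    (φ : R →ₗ[ℂ] ℂ) (hφ : ∀ x ∈ I, 0 ≤ φ (star x * x)) {x y : R} (hx : x ∈ I) (hy : y ∈ I) :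
    ‖φ (star x * y)‖ ^ 2 ≤ (φ (star x * x)).re * (φ (star y * y)).re := by
  have key : ∀ l : ℂ, 0 ≤ φ (star x * x) + l * φ (star x * y) + star l * φ (star y * x)
      + star l * l * φ (star y * y) := by
    intro l
    have := hφ (x + l • y) (I.add_mem hx (I.smul_mem l hy))
    simp only [star_add, star_smul, add_mul, mul_add, smul_mul_assoc, mul_smul_comm, map_add,
      map_smul, smul_eq_mul] at this
    convert this using 1
    ring
  have h0x := hφ x hx
  have h0y := hφ y hy
  set a := φ (star x * x)
  set d := φ (star y * y)
  set s := φ (star x * y)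
  set t := φ (star y * x)
  have k1 := (Complex.le_def.1 (key 1)).2
  have k2 := (Complex.le_def.1 (key Complex.I)).2
  have ha := (Complex.le_def.1 h0x)
  have hd := (Complex.le_def.1 h0y)
  simp at k1 k2 ha hd
  have hre : t.re = s.re := by linarith
  have him : t.im = -s.im := by linarith
  have hs : ‖s‖ ^ 2 = s.re ^ 2 + s.im ^ 2 := by
    rw [← Complex.normSq_eq_norm_sq, Complex.normSq_apply]; ring
  have kr : ∀ r : ℝ, 0 ≤ (‖s‖ ^ 2 * d.re) * (r * r) + (2 * ‖s‖ ^ 2) * r + a.re := by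
    intro r
    have := (Complex.le_def.1 (key (r * star s))).1
    simp [hre, him] at this
    rw [hs]
    rw [← hd.2] at this
    linarith
  have := discrim_le_zero kr
  rw [discrim] at this
  rcases eq_or_lt_of_le (sq_nonneg ‖s‖) with h | h
  · rw [← h]; exact mul_nonneg ha.1 hd.1
  · have h4 : ‖s‖ ^ 2 * ‖s‖ ^ 2 ≤ ‖s‖ ^ 2 * (a.re * d.re) := by linarith
    exact le_of_mul_le_mul_left h4 h

variable {B : Type*} [CStarAlgebra B]

theorem norm_star_mul_self_sub_algebraMap_le {b : B} {r : ℝ} (hr : ‖star b * b‖ ≤ 2 * r) :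
    ‖star b * b - algebraMap ℝ B r‖ ≤ r := by
  rcases subsingleton_or_nontrivial B with _ | _
  · rw [Subsingleton.elim (star b * b - algebraMap ℝ B r) 0, norm_zero]
    linarith [norm_nonneg (star b * b)]
  have hr0 : 0 ≤ r := by linarith [norm_nonneg (star b * b)]
  have hsa : IsSelfAdjoint (star b * b) := .star_mul_self b
  have h1 : star b * b - algebraMap ℝ B r = cfc (fun x : ℝ => x - r) (star b * b) := by
    rw [cfc_sub (fun x : ℝ => x) (fun _ => r), cfc_id' ℝ (star b * b), cfc_const r (star b * b)]
  rw [h1]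
  refine norm_cfc_le hr0 fun x hx => ?_
  have h2 := spectrum_star_mul_self_nonneg x hx
  have h3 := (spectrum.norm_le_norm_of_mem hx)
  rw [Real.norm_of_nonneg h2] at h3
  rw [Real.norm_eq_abs, abs_le]
  constructor <;> linarith

theorem apply_star_mul_self_nonneg_of_norm_le_one {f : B →L[ℂ] ℂ} (hf : ‖f‖ ≤ 1)
    (hf1 : f 1 = 1) (b : B) : 0 ≤ f (star b * b) := by
  have : Nontrivial B := ⟨1, 0, fun h => by simp [h] at hf1⟩
  set a := star b * b with ha
  set r : ℝ := ‖a‖ / 2 with hr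
  have hn : ‖a - algebraMap ℝ B r‖ ≤ r :=
    norm_star_mul_self_sub_algebraMap_le (by rw [hr]; linarith)
  have hsa : IsSelfAdjoint (a - algebraMap ℝ B r) :=
    (IsSelfAdjoint.star_mul_self b).sub (.algebraMap B (.all r))
  set d := a - algebraMap ℝ B r with hd
  have hfd : f d = f a - r := by
    rw [hd, map_sub, IsScalarTower.algebraMap_apply ℝ ℂ B, Algebra.algebraMap_eq_smul_one (A := B),
      map_smul, hf1]
    simp
  have key : ∀ s : ℝ, ((f a).re - r) ^ 2 + ((f a).im - s) ^ 2 ≤ r ^ 2 + s ^ 2 := by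
    intro s
    have e1 : ‖d - (Complex.I * s) • (1 : B)‖ ^ 2 ≤ r ^ 2 + s ^ 2 := by
      rw [sq, ← CStarRing.norm_star_mul_self]
      have : star (d - (Complex.I * s) • (1 : B)) * (d - (Complex.I * s) • (1 : B))
          = d * d + ((s ^ 2 : ℝ) : ℂ) • (1 : B) := by
        have hI : (Complex.I * s) * (Complex.I * s) = -((s ^ 2 : ℝ) : ℂ) := by
          rw [mul_mul_mul_comm, Complex.I_mul_I]
          push_cast
          ring
        have hI' : star (Complex.I * (s : ℂ)) = -(Complex.I * s) := by simp
        simp only [star_sub, star_smul, star_one, hsa.star_eq, sub_mul, mul_sub, smul_mul_assoc,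
          mul_smul_comm, one_mul, mul_one, hI', smul_sub, smul_neg, smul_smul, neg_smul, neg_mul, hI]
        abel
      rw [this]
      refine (norm_add_le _ _).trans (add_le_add ?_ ?_)
      · rw [sq]
        exact (norm_mul_le _ _).trans (mul_le_mul hn hn (norm_nonneg _) ((norm_nonneg _).trans hn))
      · rw [norm_smul, Complex.norm_real, Real.norm_of_nonneg (sq_nonneg s)]
        exact mul_le_of_le_one_right (sq_nonneg s) CStarRing.norm_one.le
    have e2 : ‖f (d - (Complex.I * s) • (1 : B))‖ ≤ ‖d - (Complex.I * s) • (1 : B)‖ :=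
      (f.le_of_opNorm_le hf _).trans_eq (one_mul _)
    have e3 : ‖f (d - (Complex.I * s) • (1 : B))‖ ^ 2 ≤ r ^ 2 + s ^ 2 :=
      (pow_le_pow_left₀ (norm_nonneg _) e2 2).trans e1
    rw [map_sub, map_smul, hf1, hfd, ← Complex.normSq_eq_norm_sq, Complex.normSq_apply] at e3
    simp at e3
    linarith
  have him : (f a).im = 0 := by
    have h1 := key ((((f a).re - r) ^ 2 + (f a).im ^ 2 - r ^ 2 - 1) / (2 * (f a).im))
    by_contra h
    have : 2 * (f a).im * ((((f a).re - r) ^ 2 + (f a).im ^ 2 - r ^ 2 - 1) / (2 * (f a).im))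
      = (((f a).re - r) ^ 2 + (f a).im ^ 2 - r ^ 2 - 1) := by field_simp
    nlinarith
  rw [Complex.le_def]
  refine ⟨?_, him.symm⟩
  have h0 := key 0
  rw [him] at h0
  have hr0 : 0 ≤ r := by positivity
  have : |(f a).re - r| ≤ r := abs_le_of_sq_le_sq (by linarith) hr0
  have := (abs_le.1 this).1
  simp
  linarith

theorem re_apply_star_mul_self_mul_le {g : B →L[ℂ] ℂ} (hg : ∀ b, 0 ≤ g (star b * b)) (b x : B) :
    (g (star (b * x) * (b * x))).re ≤ ‖b‖ ^ 2 * (g (star x * x)).re := by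
  let _ := CStarAlgebra.spectralOrder B
  let _ := CStarAlgebra.spectralOrderedRing B
  obtain ⟨d, hd⟩ := CStarAlgebra.nonneg_iff_eq_star_mul_self.1
    (sub_nonneg.2 (CStarAlgebra.star_mul_le_algebraMap_norm_sq (a := b)))
  have h := (Complex.le_def.1 (hg (d * x))).1
  have e : star (d * x) * (d * x)
      = ((‖b‖ ^ 2 : ℝ) : ℂ) • (star x * x) - star (b * x) * (b * x) := by
    rw [star_mul, mul_assoc, ← mul_assoc (star d), ← hd, Algebra.algebraMap_eq_smul_one,
      Complex.coe_smul]
    simp only [sub_mul, mul_sub, smul_mul_assoc, one_mul, mul_smul_comm, star_mul, mul_assoc]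
  rw [e, map_sub, map_smul, smul_eq_mul, Complex.sub_re, Complex.re_ofReal_mul] at h
  simpa using h

theorem norm_apply_le_re_apply_one {g : B →L[ℂ] ℂ} (hg : ∀ b, 0 ≤ g (star b * b)) (b : B) :
    ‖g b‖ ≤ (g 1).re * ‖b‖ := by
  have h1 := norm_sq_apply_star_mul_le ⊤ g.toLinearMap (fun x _ => hg x)
    (x := 1) (y := b) trivial trivial
  have h2 := re_apply_star_mul_self_mul_le hg b 1
  have h3 := (Complex.le_def.1 (hg 1)).1
  simp at h1 h2 h3
  refine le_of_sq_le_sq (h1.trans ?_) (by positivity)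
  nlinarith [mul_le_mul_of_nonneg_left h2 h3]

theorem norm_sq_apply_sub_mul_star_mul_self_le {f : B →L[ℂ] ℂ} (hf : ‖f‖ ≤ 1)
    (hf1 : f 1 = 1) {c : B} (hc : ‖c‖ ≤ 1) (y : B) :
    ‖f (y - y * (star c * c))‖ ^ 2 ≤ (1 - (f (star c * c)).re) * ‖y‖ ^ 2 := by
  have hpos := apply_star_mul_self_nonneg_of_norm_le_one hf hf1
  have h1 := norm_sq_apply_star_mul_le ⊤ f.toLinearMap (fun x _ => hpos x)
    (x := star y) (y := 1 - star c * c) trivial trivial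
  have h2 := re_apply_star_mul_self_mul_le hpos (star c) c
  have h3 := re_apply_star_mul_self_mul_le hpos (star y) 1
  have h4 := (Complex.le_def.1 (hpos c)).1
  have h5 : star (1 - star c * c) * (1 - star c * c)
      = 1 - star c * c - star c * c + star (star c * c) * (star c * c) := by
    simp only [star_sub, star_one, star_mul, star_star]
    noncomm_ring
  have h6 : ‖star c‖ ^ 2 ≤ 1 := by
    rw [norm_star]
    exact pow_le_one₀ (norm_nonneg _) hc
  have h7 : (f (star (1 - star c * c) * (1 - star c * c))).re ≤ 1 - (f (star c * c)).re := by
    rw [h5]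
    simp only [map_sub, map_add, hf1, Complex.sub_re, Complex.add_re, Complex.one_re]
    have : ‖star c‖ ^ 2 * (f (star c * c)).re ≤ (f (star c * c)).re := mul_le_of_le_one_left h4 h6
    linarith
  have h8 := (Complex.le_def.1 (hpos (1 - star c * c))).1
  have h9 : y - y * (star c * c) = star (star y) * (1 - star c * c) := by
    rw [star_star, mul_sub, mul_one]
  simp only [mul_one, star_one, hf1, Complex.one_re, norm_star] at h3
  rw [h9, mul_comm (1 - _)]
  exact h1.trans (mul_le_mul h3 h7 h8 (by positivity))

end PositiveFunctionals

section Ideals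

variable {A : Type*} [NonUnitalCStarAlgebra A]

theorem IsClosedTwoSidedIdeal.top : IsClosedTwoSidedIdeal (⊤ : Submodule ℂ A) :=
  ⟨isClosed_univ, fun _ _ _ => trivial, fun _ _ _ => trivial⟩

/-- Every element of a closed two-sided ideal is almost fixed by left multiplication by some
self-adjoint contraction of the ideal. -/
theorem IsClosedTwoSidedIdeal.exists_norm_sub_mul_lt {I : Submodule ℂ A}
    (hI : IsClosedTwoSidedIdeal I) {x : A} (hx : x ∈ I) {ε : ℝ} (hε : 0 < ε) :
    ∃ c ∈ I, IsSelfAdjoint c ∧ ‖c‖ ≤ 1 ∧ ‖x - c * x‖ < ε := by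
  set h := x * star x with hh
  have hsa : IsSelfAdjoint h := .mul_star_self x
  set η : ℝ := ε ^ 2 with hη
  have hη0 : 0 < η := by positivity
  have hden : ∀ t : ℝ, 0 < t ^ 2 + η ^ 2 := fun t => by positivity
  have hden' : ∀ t : ℝ, t ^ 2 + η ^ 2 ≠ 0 := fun t => (hden t).ne'
  let k : ℝ → ℝ := fun t => t / (t ^ 2 + η ^ 2)
  let g : ℝ → ℝ := fun t => t * k t
  have hk : Continuous k := by fun_prop (disch := exact hden' _)
  have hg : Continuous g := by fun_prop
  have hk0 : k 0 = 0 := by simp [k]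
  have hg0 : g 0 = 0 := by simp [g]
  have hgh : cfcₙ g h = h * cfcₙ k h := by
    rw [cfcₙ_mul (fun t : ℝ => t) k h, cfcₙ_id' ℝ h]
  have hcsa : IsSelfAdjoint (cfcₙ g h) := cfcₙ_predicate g h
  refine ⟨cfcₙ g h, ?_, hcsa, ?_, ?_⟩
  · rw [hgh]
    exact hI.2.2 _ _ (hI.2.2 _ _ hx)
  · refine norm_cfcₙ_le fun t _ => ?_
    simp only [g, k]
    rw [Real.norm_eq_abs, mul_div_assoc', abs_of_nonneg (div_nonneg (mul_self_nonneg t) (hden t).le),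
      div_le_one (hden t)]
    nlinarith [sq_nonneg η]
  · refine lt_of_pow_lt_pow_left₀ 2 hε.le ?_
    rw [sq, ← CStarRing.norm_self_mul_star]
    have e : (x - cfcₙ g h * x) * star (x - cfcₙ g h * x)
        = cfcₙ (fun t : ℝ => t - g t * t - t * g t + g t * t * g t) h := by
      rw [cfcₙ_add (fun t : ℝ => t - g t * t - t * g t) (fun t => g t * t * g t) h,
        cfcₙ_sub (fun t : ℝ => t - g t * t) (fun t => t * g t) h,
        cfcₙ_sub (fun t : ℝ => t) (fun t => g t * t) h,
        cfcₙ_mul (fun t => g t * t) g h, cfcₙ_mul g (fun t => t) h, cfcₙ_mul (fun t => t) g h,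
        cfcₙ_id' ℝ h, star_sub, star_mul, hcsa.star_eq]
      simp only [sub_mul, mul_sub, hh, mul_assoc]
      abel
    rw [e]
    refine (norm_cfcₙ_le (c := η / 2) fun t _ => ?_).trans_lt (by linarith)
    have e2 : t - g t * t - t * g t + g t * t * g t
        = (t * η / (t ^ 2 + η ^ 2)) * (η ^ 2 / (t ^ 2 + η ^ 2)) * η := by
      simp only [g, k]
      field_simp [hden' t]
      ring
    have h1 : ‖t * η / (t ^ 2 + η ^ 2)‖ ≤ 1 / 2 := by
      rw [Real.norm_eq_abs, abs_le, le_div_iff₀ (hden t), div_le_iff₀ (hden t)]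
      constructor <;> nlinarith [sq_nonneg (t - η), sq_nonneg (t + η)]
    have h2 : ‖η ^ 2 / (t ^ 2 + η ^ 2)‖ ≤ 1 := by
      rw [Real.norm_of_nonneg (by positivity), div_le_one (hden t)]
      nlinarith [sq_nonneg t]
    rw [e2, norm_mul, norm_mul, Real.norm_of_nonneg hη0.le]
    calc _ ≤ 1 / 2 * 1 * η := by gcongr
      _ = η / 2 := by ring

theorem exists_lt_re_apply_star_mul_self {I : Submodule ℂ A} (hI : IsClosedTwoSidedIdeal I)
    {ψ : A →L[ℂ] ℂ} (hψ : IsStateOfIdeal I (ψ.comp I.subtypeL)) {ε : ℝ} (hε : 0 < ε) :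
    ∃ c ∈ I, ‖c‖ ≤ 1 ∧ 1 - ε < (ψ (star c * c)).re := by
  have hpos : ∀ x ∈ I, 0 ≤ ψ (star x * x) := fun x hx =>
    hψ.1 ⟨x, hx⟩ ⟨star x * x, hI.2.1 _ _ hx⟩ rfl
  have hle : ∀ x ∈ I, ‖ψ x‖ ≤ ‖x‖ := fun x hx => by
    simpa using (ψ.comp I.subtypeL).le_of_opNorm_le hψ.2.le ⟨x, hx⟩
  obtain ⟨x, hx1, hx⟩ := (ψ.comp I.subtypeL).exists_lt_apply_of_lt_opNorm
    (show 1 - ε / 4 < _ by rw [hψ.2]; linarith)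
  obtain ⟨x, hxI⟩ := x
  obtain ⟨c, hc, hcs, hc1, hcx⟩ := hI.exists_norm_sub_mul_lt hxI (show 0 < ε / 4 by linarith)
  refine ⟨c, hc, hc1, ?_⟩
  have h1 := norm_sq_apply_star_mul_le I ψ.toLinearMap hpos hc hxI
  have h2 := hle _ (I.sub_mem hxI (hI.2.1 c x hxI))
  have h3 := hle _ (hI.2.1 (star x) x hxI)
  have h4 := (Complex.le_def.1 (hpos c hc)).1
  have h5 := Complex.re_le_norm (ψ (star x * x))
  rw [map_sub] at h2
  rw [CStarRing.norm_star_mul_self] at h3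
  have h6 := norm_sub_norm_le (ψ x) (ψ (c * x))
  rw [hcs.star_eq] at h1
  rw [hcs.star_eq] at h4 ⊢
  simp at hx hx1 h1 h4
  have h7 : (ψ (star x * x)).re ≤ 1 := by nlinarith [norm_nonneg x]
  have h8 : ‖ψ (c * x)‖ ^ 2 ≤ (ψ (c * c)).re := h1.trans (mul_le_of_le_one_right h4 h7)
  have h9 : 1 - ε / 2 < ‖ψ (c * x)‖ := by linarith
  by_cases h : 1 - ε < 0
  · linarith
  · nlinarith

variable (A) in
/-- The inclusion of a C*-algebra into its unitization as a linear isometry. -/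
def unitizationInrIsometry : A →ₗᵢ[ℂ] Unitization ℂ A :=
  ⟨(Unitization.inrNonUnitalAlgHom ℂ A : A →ₗ[ℂ] Unitization ℂ A), Unitization.norm_inr⟩

theorem unitizationInrIsometry_apply (a : A) : unitizationInrIsometry A a = a := rfl

theorem IsStateOfIdeal.exists_extension {I : Submodule ℂ A} (hI : IsClosedTwoSidedIdeal I)
    {φ : I →L[ℂ] ℂ} (hφ : IsStateOfIdeal I φ) :
    ∃ f : Unitization ℂ A →L[ℂ] ℂ, (∀ x : I, f ((x : A) : Unitization ℂ A) = φ x) ∧ ‖f‖ ≤ 1 ∧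
      f 1 = 1 := by
  let L' : I →ₗᵢ[ℂ] Unitization ℂ A := (unitizationInrIsometry A).comp I.subtypeₗᵢ
  obtain ⟨f, hf, hfn⟩ := exists_extension_norm_eq L'.toLinearMap.range
    (φ.comp (L'.equivRange.symm : _ →L[ℂ] I))
  have hfx : ∀ x : I, f ((x : A) : Unitization ℂ A) = φ x := fun x => by
    have h := hf (L'.equivRange x)
    rw [ContinuousLinearMap.comp_apply] at h
    refine h.trans (congrArg φ ?_)
    exact L'.equivRange.symm_apply_apply x
  have hfn : ‖f‖ = 1 := by
    rw [hfn, ← hφ.2]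
    exact ContinuousLinearMap.opNorm_comp_linearIsometryEquiv φ L'.equivRange.symm
  refine ⟨f, hfx, hfn.le, ?_⟩
  let ψ : A →L[ℂ] ℂ := f.comp (unitizationInrIsometry A).toContinuousLinearMap
  have hψ : ψ.comp I.subtypeL = φ := by
    ext x
    exact hfx x
  have hψφ : IsStateOfIdeal I (ψ.comp I.subtypeL) := hψ.symm ▸ hφ
  have hle : ∀ b, ‖f b‖ ≤ ‖b‖ := fun b => (f.le_of_opNorm_le hfn.le b).trans_eq (one_mul _)
  have h1 : ‖(2 : ℂ) - f 1‖ ≤ 1 := by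
    refine le_of_forall_pos_le_add fun ε hε => ?_
    obtain ⟨c, hc, hc1, hcε⟩ := exists_lt_re_apply_star_mul_self hI hψφ
      (show 0 < ε / 2 by linarith)
    set p : Unitization ℂ A := star (c : Unitization ℂ A) * c with hp
    have hpc : f p = ψ (star c * c) := by
      simp [ψ, hp, unitizationInrIsometry_apply]
    have hc0 := Complex.le_def.1 (hψφ.1 ⟨c, hc⟩ ⟨star c * c, hI.2.1 _ _ hc⟩ rfl)
    have hpn : ‖p‖ ≤ 1 := by
      rw [hp, CStarRing.norm_star_mul_self, Unitization.norm_inr]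
      exact mul_le_one₀ hc1 (norm_nonneg _) hc1
    have e1 := hle (p - algebraMap ℝ _ (1 / 2))
    have e2 := norm_star_mul_self_sub_algebraMap_le (b := (c : Unitization ℂ A)) (r := 1 / 2)
      (by rw [← hp]; linarith)
    rw [← hp] at e2
    have e3 : f (p - algebraMap ℝ _ (1 / 2)) = f p - (1 / 2) * f 1 := by
      rw [map_sub, IsScalarTower.algebraMap_apply ℝ ℂ (Unitization ℂ A),
        Algebra.algebraMap_eq_smul_one (A := Unitization ℂ A), map_smul]
      simp
    have e4 : ‖1 - f p‖ ≤ ε / 2 := by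
      have h5 := (Complex.re_le_norm (f p)).trans ((hle p).trans hpn)
      have h6 : 1 - f p = ((1 - (f p).re : ℝ) : ℂ) := by
        refine Complex.ext (by simp) ?_
        rw [hpc]
        simpa using hc0.2.symm
      rw [h6, Complex.norm_real, Real.norm_of_nonneg (by linarith), hpc]
      linarith
    have e5 : 2 - f 1 = 2 * (f p - (1 / 2) * f 1) + 2 * (1 - f p) := by ring
    rw [e5]
    refine (norm_add_le _ _).trans ?_
    rw [norm_mul, norm_mul, ← e3, Complex.norm_ofNat]
    linarith
  have h2 : ‖f 1‖ ≤ 1 := (hle 1).trans_eq norm_one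
  have h3 := Complex.re_le_norm (2 - f 1)
  have h4 := Complex.re_le_norm (f 1)
  have h5 := Complex.normSq_eq_norm_sq (f 1)
  rw [Complex.normSq_apply] at h5
  simp at h3
  have h6 : (f 1).re = 1 := by linarith
  rw [h6] at h5
  refine Complex.ext h6 ?_
  simp
  nlinarith [norm_nonneg (f 1)]

theorem IsState.norm_comp_subtypeL_le {φ : A →L[ℂ] ℂ} (hφ : IsState A φ) (I : Submodule ℂ A) :
    ‖φ.comp I.subtypeL‖ ≤ 1 :=
  ContinuousLinearMap.opNorm_le_bound _ zero_le_one fun x => φ.le_of_opNorm_le hφ.2.le x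

theorem IsState.isStateOfIdeal {φ : A →L[ℂ] ℂ} (hφ : IsState A φ) {I : Submodule ℂ A}
    (h : 1 ≤ ‖φ.comp I.subtypeL‖) : IsStateOfIdeal I (φ.comp I.subtypeL) := by
  refine ⟨fun x y hxy => ?_, (hφ.norm_comp_subtypeL_le I).antisymm h⟩
  rw [ContinuousLinearMap.comp_apply, Submodule.subtypeL_apply, hxy]
  exact hφ.1 x

theorem IsState.exists_extension {φ : A →L[ℂ] ℂ} (hφ : IsState A φ) :
    ∃ f : Unitization ℂ A →L[ℂ] ℂ, (∀ a : A, f (a : Unitization ℂ A) = φ a) ∧ ‖f‖ ≤ 1 ∧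
      f 1 = 1 := by
  have h : 1 ≤ ‖φ.comp (⊤ : Submodule ℂ A).subtypeL‖ := by
    rw [← hφ.2]
    exact φ.opNorm_le_bound (ContinuousLinearMap.opNorm_nonneg _) fun a =>
      (φ.comp (⊤ : Submodule ℂ A).subtypeL).le_opNorm ⟨a, trivial⟩
  obtain ⟨f, hf, h1⟩ := (hφ.isStateOfIdeal h).exists_extension .top
  exact ⟨f, fun a => hf ⟨a, trivial⟩, h1⟩

theorem IsState.norm_sq_apply_sub_mul_le {φ : A →L[ℂ] ℂ} (hφ : IsState A φ) {c : A}
    (hc : ‖c‖ ≤ 1) (a : A) :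
    ‖φ (a - a * (star c * c))‖ ^ 2 ≤ (1 - (φ (star c * c)).re) * ‖a‖ ^ 2 := by
  obtain ⟨f, hf, hfn, hf1⟩ := hφ.exists_extension
  have h := norm_sq_apply_sub_mul_star_mul_self_le hfn hf1 (c := (c : Unitization ℂ A))
    (by rwa [Unitization.norm_inr]) a
  rw [Unitization.norm_inr] at h
  rw [← hf, ← hf]
  simpa using h

theorem isState_comp_unitizationInrIsometry {f : Unitization ℂ A →L[ℂ] ℂ} (hf : ‖f‖ ≤ 1)
    (hf1 : f 1 = 1) {I : Submodule ℂ A} {τ : I →L[ℂ] ℂ} (hτ : ‖τ‖ = 1)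
    (hfτ : ∀ x : I, f ((x : A) : Unitization ℂ A) = τ x) :
    IsState A (f.comp (unitizationInrIsometry A).toContinuousLinearMap) := by
  refine ⟨fun a => ?_, le_antisymm ?_ ?_⟩
  · have := apply_star_mul_self_nonneg_of_norm_le_one hf hf1 (a : Unitization ℂ A)
    simpa [unitizationInrIsometry_apply] using this
  · refine ContinuousLinearMap.opNorm_le_bound _ zero_le_one fun a => ?_
    refine (f.le_of_opNorm_le hf _).trans_eq ?_
    rw [← (unitizationInrIsometry A).norm_map a]
    rfl
  · rw [← hτ]
    refine τ.opNorm_le_bound (norm_nonneg _) fun x => ?_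
    rw [← hfτ]
    exact (f.comp (unitizationInrIsometry A).toContinuousLinearMap).le_opNorm x

theorem IsStateOfIdeal.exists_isState {I : Submodule ℂ A} (hI : IsClosedTwoSidedIdeal I)
    {τ : I →L[ℂ] ℂ} (hτ : IsStateOfIdeal I τ) :
    ∃ φ : A →L[ℂ] ℂ, IsState A φ ∧ φ.comp I.subtypeL = τ := by
  obtain ⟨f, hf, hfn, hf1⟩ := hτ.exists_extension hI
  exact ⟨_, isState_comp_unitizationInrIsometry hfn hf1 hτ.2 hf, ContinuousLinearMap.ext hf⟩

theorem IsState.norm_sub_apply_le {φ ψ : A →L[ℂ] ℂ} (hφ : IsState A φ) (hψ : IsState A ψ)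
    {c : A} (hc : ‖c‖ ≤ 1) (a : A) :
    ‖φ a - ψ a‖ ≤ ‖φ (a * (star c * c)) - ψ (a * (star c * c))‖
      + (√(1 - (φ (star c * c)).re) + √(1 - (ψ (star c * c)).re)) * ‖a‖ := by
  have h : ∀ {χ : A →L[ℂ] ℂ}, IsState A χ →
      ‖χ (a - a * (star c * c))‖ ≤ √(1 - (χ (star c * c)).re) * ‖a‖ := fun hχ => by
    rw [← Real.sqrt_sq (norm_nonneg a), ← Real.sqrt_mul' _ (sq_nonneg _)]
    exact Real.le_sqrt_of_sq_le (hχ.norm_sq_apply_sub_mul_le hc a)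
  have e : φ a - ψ a = (φ (a * (star c * c)) - ψ (a * (star c * c)))
      + (φ (a - a * (star c * c)) - ψ (a - a * (star c * c))) := by
    simp only [map_sub]
    ring
  rw [e, add_mul]
  exact (norm_add_le _ _).trans (add_le_add le_rfl
    ((norm_sub_le _ _).trans (add_le_add (h hφ) (h hψ))))

theorem IsState.eq_of_comp_subtypeL_eq {I : Submodule ℂ A} (hI : IsClosedTwoSidedIdeal I)
    {φ ψ : A →L[ℂ] ℂ} (hφ : IsState A φ) (hψ : IsState A ψ)
    (hφI : IsStateOfIdeal I (φ.comp I.subtypeL)) (h : φ.comp I.subtypeL = ψ.comp I.subtypeL) :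
    φ = ψ := by
  have hx : ∀ x ∈ I, φ x = ψ x := fun x hx => congr($h ⟨x, hx⟩)
  ext a
  rw [← sub_eq_zero, ← norm_le_zero_iff]
  refine le_of_forall_pos_le_add fun ε hε => ?_
  obtain ⟨c, hc, hc1, hcε⟩ := exists_lt_re_apply_star_mul_self hI hφI
    (show 0 < (ε / (2 * (‖a‖ + 1))) ^ 2 by positivity)
  have hcc : star c * c ∈ I := hI.2.1 _ _ hc
  refine (hφ.norm_sub_apply_le hψ hc1 a).trans ?_
  rw [hx _ (hI.2.1 a _ hcc), ← hx _ hcc, sub_self, norm_zero]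
  have h1 : √(1 - (φ (star c * c)).re) ≤ ε / (2 * (‖a‖ + 1)) :=
    Real.sqrt_le_iff.2 ⟨by positivity, by linarith⟩
  have h2 : ε / (2 * (‖a‖ + 1)) * (2 * (‖a‖ + 1)) = ε := by field_simp
  have h3 : 0 < ε / (2 * (‖a‖ + 1)) := by positivity
  nlinarith [norm_nonneg a, mul_le_mul_of_nonneg_right h1 (norm_nonneg a)]

theorem apply_star_mul_self_sub_nonneg {I : Submodule ℂ A} (hI : IsClosedTwoSidedIdeal I)
    {τ : I →L[ℂ] ℂ} (hτ : IsStateOfIdeal I τ) {f f' : Unitization ℂ A →L[ℂ] ℂ} (hf : ‖f‖ ≤ 1)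
    (hf1 : f 1 = 1) (hf' : ‖f'‖ ≤ 1) (hfone : f' 1 = 1)
    (hτf : ∀ x : I, f' ((x : A) : Unitization ℂ A) = τ x) {t : ℝ} (ht0 : 0 ≤ t) (ht1 : t ≤ 1)
    (hff' : ∀ x ∈ I, f (x : Unitization ℂ A) = t * f' (x : Unitization ℂ A))
    (b : Unitization ℂ A) : 0 ≤ f (star b * b) - t * f' (star b * b) := by
  have hl : ∀ x ∈ I, ∀ u : Unitization ℂ A, f (u * x) = t * f' (u * x) := fun x hx u => by
    obtain ⟨v, hv, hvu⟩ : ∃ v ∈ I, u * (x : Unitization ℂ A) = v := by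
      induction u using Unitization.ind with
      | inl_add_inr r a =>
        refine ⟨r • x + a * x, I.add_mem (I.smul_mem r hx) (hI.2.1 a x hx), ?_⟩
        simp [add_mul, Unitization.inl_mul_inr]
    rw [hvu, hff' v hv]
  have hr : ∀ x ∈ I, ∀ u : Unitization ℂ A, f (x * u) = t * f' (x * u) := fun x hx u => by
    obtain ⟨v, hv, hvu⟩ : ∃ v ∈ I, (x : Unitization ℂ A) * u = v := by
      induction u using Unitization.ind with
      | inl_add_inr r a =>
        refine ⟨r • x + x * a, I.add_mem (I.smul_mem r hx) (hI.2.2 a x hx), ?_⟩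
        simp [mul_add, Unitization.inr_mul_inl]
    rw [hvu, hff' v hv]
  have hcl : IsClosed {z : ℂ | 0 ≤ z} := isClosed_le continuous_const continuous_id
  refine hcl.closure_eq.subset (Metric.mem_closure_iff.2 ?_)
  intro ε hε
  have hψ : IsStateOfIdeal I
      ((f'.comp (unitizationInrIsometry A).toContinuousLinearMap).comp I.subtypeL) := by
    convert hτ
    exact ContinuousLinearMap.ext hτf
  obtain ⟨c, hc, hc1, hcε⟩ := exists_lt_re_apply_star_mul_self hI hψ
    (show 0 < (ε / (2 * ‖b‖ ^ 2 + 1)) ^ 2 by positivity)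
  set C : Unitization ℂ A := (c : Unitization ℂ A) with hC
  set p : A := star c * c with hp
  have hpI : p ∈ I := hI.2.1 _ _ hc
  have hCp : star C * C = (p : Unitization ℂ A) := by simp [hC, hp]
  have hC1 : ‖C‖ ≤ 1 := by rwa [hC, Unitization.norm_inr]
  have hP1 : ‖(p : Unitization ℂ A)‖ ≤ 1 := by
    rw [← hCp, CStarRing.norm_star_mul_self]
    exact mul_le_one₀ hC1 (norm_nonneg _) hC1
  have hPs : star (p : Unitization ℂ A) = p := by rw [← hCp, star_mul, star_star]
  set d := b - b * (p : Unitization ℂ A) with hd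
  set y := star d * b with hy
  have hdd : star d * d = y - y * p := by rw [hd, mul_sub, ← hd, hy, mul_assoc]
  have hbb : star b * b = star d * d + y * p + p * (star b * b) := by
    rw [hdd, hy, hd, star_sub, star_mul, hPs]
    noncomm_ring
  have hyn : ‖y‖ ≤ 2 * ‖b‖ ^ 2 := by
    have h1 : ‖d‖ ≤ ‖b‖ + ‖b‖ * 1 := (norm_sub_le _ _).trans
      (add_le_add le_rfl ((norm_mul_le _ _).trans (mul_le_mul_of_nonneg_left hP1 (norm_nonneg b))))
    calc ‖y‖ ≤ ‖d‖ * ‖b‖ := (norm_mul_le _ _).trans_eq (by rw [norm_star])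
      _ ≤ (‖b‖ + ‖b‖ * 1) * ‖b‖ := mul_le_mul_of_nonneg_right h1 (norm_nonneg b)
      _ = 2 * ‖b‖ ^ 2 := by ring
  refine ⟨f (star d * d), apply_star_mul_self_nonneg_of_norm_le_one hf hf1 d, ?_⟩
  have hval : f (star b * b) - t * f' (star b * b) - f (star d * d) = -(t * f' (y - y * p)) := by
    rw [hbb]
    simp only [map_add]
    rw [hl p hpI, hr p hpI, hdd]
    ring
  rw [dist_eq_norm, hval, norm_neg, norm_mul, Complex.norm_real, Real.norm_of_nonneg ht0]
  refine (mul_le_of_le_one_left (norm_nonneg _) ht1).trans_lt ?_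
  have hsq := norm_sq_apply_sub_mul_star_mul_self_le hf' hfone hC1 y
  rw [hCp] at hsq
  have hcε' : 1 - (f' (p : Unitization ℂ A)).re ≤ (ε / (2 * ‖b‖ ^ 2 + 1)) ^ 2 := by
    have : 1 - (ε / (2 * ‖b‖ ^ 2 + 1)) ^ 2 < (f' (p : Unitization ℂ A)).re := hcε
    linarith
  have hle : ‖f' (y - y * p)‖ ≤ ε / (2 * ‖b‖ ^ 2 + 1) * ‖y‖ := by
    refine le_of_sq_le_sq (hsq.trans ?_) (by positivity)
    rw [mul_pow]
    exact mul_le_mul_of_nonneg_right hcε' (sq_nonneg _)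
  refine hle.trans_lt ?_
  rw [div_mul_eq_mul_div, div_lt_iff₀ (by positivity)]
  exact mul_lt_mul_of_pos_left (by linarith) hε

theorem norm_real_smul_continuousLinearMap {E : Type*} [SeminormedAddCommGroup E] [NormedSpace ℂ E]
    {s : ℝ} (hs : 0 ≤ s) (φ : E →L[ℂ] ℂ) : ‖s • φ‖ = s * ‖φ‖ := by
  have : s • φ = (s : ℂ) • φ := by
    ext
    simp
  rw [this, norm_smul, Complex.norm_real, Real.norm_of_nonneg hs]

theorem IsPureState.isStateOfIdeal {I : Submodule ℂ A} (hI : IsClosedTwoSidedIdeal I)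
    {φ : A →L[ℂ] ℂ} (hφ : IsPureState A φ) {x : A} (hx : x ∈ I) (hφx : φ x ≠ 0) :
    IsStateOfIdeal I (φ.comp I.subtypeL) := by
  have hs : IsState A φ := hφ.1
  refine hs.isStateOfIdeal ?_
  by_contra! hlt
  set t : ℝ := ‖φ.comp I.subtypeL‖ with ht
  have ht0 : 0 < t := by
    refine (norm_nonneg (φ.comp I.subtypeL)).lt_of_ne fun h => hφx ?_
    have := (φ.comp I.subtypeL).le_opNorm ⟨x, hx⟩
    rw [← h, zero_mul] at this
    exact norm_le_zero_iff.1 this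
  have hτ : IsStateOfIdeal I (t⁻¹ • φ.comp I.subtypeL) := by
    refine ⟨fun x y hxy => ?_, ?_⟩
    · change 0 ≤ t⁻¹ • φ (y : A)
      rw [hxy]
      exact smul_nonneg (inv_nonneg.2 ht0.le) (hs.1 _)
    · rw [norm_real_smul_continuousLinearMap (inv_nonneg.2 ht0.le), ← ht, inv_mul_cancel₀ ht0.ne']
  obtain ⟨f', hτf, hf', hfone⟩ := hτ.exists_extension hI
  obtain ⟨f, hfφ, hf, hf1⟩ := hs.exists_extension
  have hIx : ∀ z ∈ I, f' (z : Unitization ℂ A) = (t : ℂ)⁻¹ * φ z := fun z hz => by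
    rw [hτf ⟨z, hz⟩]
    simp
  have htC : (t : ℂ) ≠ 0 := by exact_mod_cast ht0.ne'
  have hg := apply_star_mul_self_sub_nonneg hI hτ hf hf1 hf' hfone hτf ht0.le hlt.le
    fun z hz => by rw [hfφ, hIx z hz, mul_inv_cancel_left₀ htC]
  have hgn := norm_apply_le_re_apply_one (g := f - (t : ℂ) • f') hg
  have hg1 : ((f - (t : ℂ) • f') 1).re = 1 - t := by simp [hf1, hfone]
  have hφ' := isState_comp_unitizationInrIsometry hf' hfone hτ.2 hτf
  set φ' := f'.comp (unitizationInrIsometry A).toContinuousLinearMap with hφ'_eq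
  have hst : 0 < 1 - t := by linarith
  set κ : A →L[ℂ] ℂ := (1 - t)⁻¹ • (φ - t • φ') with hκ_def
  have hcomb : t • φ' + (1 - t) • κ = φ := by
    rw [hκ_def, smul_inv_smul₀ hst.ne']
    abel
  have hval : ∀ a : A, (φ - t • φ') a = (f - (t : ℂ) • f') (a : Unitization ℂ A) := fun a => by
    simp [hφ'_eq, hfφ, unitizationInrIsometry_apply]
  have hκ : IsState A κ := by
    refine ⟨fun a => ?_, le_antisymm ?_ ?_⟩
    · refine smul_nonneg (inv_nonneg.2 hst.le) ?_
      change 0 ≤ (φ - t • φ') (star a * a)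
      rw [hval]
      simpa using hg (a : Unitization ℂ A)
    · rw [hκ_def, norm_smul, norm_inv, Real.norm_of_nonneg hst.le, inv_mul_le_iff₀ hst, mul_one]
      refine ContinuousLinearMap.opNorm_le_bound _ hst.le fun a => ?_
      rw [hval, ← hg1, ← Unitization.norm_inr (𝕜 := ℂ) (a := a)]
      exact hgn a
    · have := norm_add_le (t • φ') ((1 - t) • κ)
      rw [hcomb, hs.2, norm_smul, norm_smul, hφ'.2, Real.norm_of_nonneg ht0.le,
        Real.norm_of_nonneg hst.le] at this
      nlinarith
  have heq : φ' = φ := (mem_extremePoints_iff_left.1 hφ).2 φ' hφ' κ hκ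
    ⟨t, 1 - t, ht0, hst, by ring, hcomb⟩
  have hx' : (t : ℂ)⁻¹ * φ x = φ x := (hIx x hx).symm.trans congr($heq x)
  have : (t : ℂ)⁻¹ = 1 := mul_right_cancel₀ hφx (hx'.trans (one_mul _).symm)
  rw [inv_eq_one] at this
  exact hlt.ne (by exact_mod_cast this)

theorem IsPureState.isPureStateOfIdeal {I : Submodule ℂ A} (hI : IsClosedTwoSidedIdeal I)
    {φ : A →L[ℂ] ℂ} (hφ : IsPureState A φ) (hφI : IsStateOfIdeal I (φ.comp I.subtypeL)) :
    IsPureStateOfIdeal I (φ.comp I.subtypeL) := by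
  refine mem_extremePoints_iff_left.2 ⟨hφI, fun τ₁ h₁ τ₂ h₂ => ?_⟩
  rintro ⟨s, t, hs, ht, hst, h⟩
  obtain ⟨φ₁, hφ₁, rfl⟩ := IsStateOfIdeal.exists_isState hI h₁
  obtain ⟨φ₂, hφ₂, rfl⟩ := IsStateOfIdeal.exists_isState hI h₂
  have hr : (s • φ₁ + t • φ₂).comp I.subtypeL = φ.comp I.subtypeL := by
    rw [← h]
    rfl
  have hst' : IsState A (s • φ₁ + t • φ₂) := by
    refine ⟨fun a => ?_, le_antisymm ?_ ?_⟩
    · have h1 := hφ₁.1 a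
      have h2 := hφ₂.1 a
      have := add_nonneg (smul_nonneg hs.le h1) (smul_nonneg ht.le h2)
      simpa using this
    · refine (norm_add_le _ _).trans ?_
      rw [norm_smul, norm_smul, hφ₁.2, hφ₂.2, Real.norm_of_nonneg hs.le, Real.norm_of_nonneg ht.le]
      linarith
    · rw [← hφI.2, ← hr]
      exact ContinuousLinearMap.opNorm_le_bound _ (norm_nonneg _) fun x =>
        (s • φ₁ + t • φ₂).le_opNorm x
  have he := IsState.eq_of_comp_subtypeL_eq hI hst' hφ.1 (by rwa [hr]) hr
  rw [(mem_extremePoints_iff_left.1 hφ).2 φ₁ hφ₁ φ₂ hφ₂ ⟨s, t, hs, ht, hst, he⟩]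

theorem IsState.isPureState_of_isPureStateOfIdeal {I : Submodule ℂ A}
    (hI : IsClosedTwoSidedIdeal I) {φ : A →L[ℂ] ℂ} (hφ : IsState A φ)
    (hφI : IsPureStateOfIdeal I (φ.comp I.subtypeL)) : IsPureState A φ := by
  refine mem_extremePoints_iff_left.2 ⟨hφ, fun φ₁ h₁ φ₂ h₂ => ?_⟩
  rintro ⟨s, t, hs, ht, hst, h⟩
  have hr : s • φ₁.comp I.subtypeL + t • φ₂.comp I.subtypeL = φ.comp I.subtypeL := by
    rw [← h]
    rfl
  have hn : 1 ≤ s * ‖φ₁.comp I.subtypeL‖ + t * ‖φ₂.comp I.subtypeL‖ := by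
    rw [← hφI.1.2, ← hr]
    refine (norm_add_le (s • φ₁.comp I.subtypeL) (t • φ₂.comp I.subtypeL)).trans_eq ?_
    rw [norm_real_smul_continuousLinearMap hs.le, norm_real_smul_continuousLinearMap ht.le]
  have hn₁ := IsState.norm_comp_subtypeL_le h₁ I
  have hn₂ := IsState.norm_comp_subtypeL_le h₂ I
  have hs₁ := IsState.isStateOfIdeal h₁ (I := I) (by nlinarith)
  have hs₂ := IsState.isStateOfIdeal h₂ (I := I) (by nlinarith)
  exact IsState.eq_of_comp_subtypeL_eq hI h₁ hφ hs₁
    ((mem_extremePoints_iff_left.1 hφI).2 _ hs₁ _ hs₂ ⟨s, t, hs, ht, hst, hr⟩)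

theorem exists_isHomeomorph_restrict (I : Submodule ℂ A) (hI : IsClosedTwoSidedIdeal I) :
    ∃ F : {φ : WeakDual ℂ A // IsPureState A φ ∧ ∃ x ∈ I, φ x ≠ 0} →
          {τ : WeakDual ℂ ↥I // IsPureStateOfIdeal I τ},
      (∀ φ, ∀ x : ↥I, (F φ).1 x = φ.1 (x : A)) ∧ IsHomeomorph F := by
  let r : WeakDual ℂ A → WeakDual ℂ I := fun φ => ContinuousLinearMap.comp φ I.subtypeL
  let F : {φ : WeakDual ℂ A // IsPureState A φ ∧ ∃ x ∈ I, φ x ≠ 0} →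
      {τ : WeakDual ℂ ↥I // IsPureStateOfIdeal I τ} := fun φ => ⟨r φ.1, by
    obtain ⟨φ, hφ, x, hx, hφx⟩ := φ
    exact hφ.isPureStateOfIdeal hI (hφ.isStateOfIdeal hI hx hφx)⟩
  have hF : ∀ φ, ∀ x : I, (F φ).1 x = φ.1 (x : A) := fun _ _ => rfl
  have hinj : Function.Injective F := fun φ ψ h =>
    Subtype.ext (IsState.eq_of_comp_subtypeL_eq hI φ.2.1.1 ψ.2.1.1 (F φ).2.1
      (congrArg Subtype.val h))
  have hsurj : Function.Surjective F := by
    rintro ⟨τ, hτ⟩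
    obtain ⟨φ, hφ, rfl⟩ := IsStateOfIdeal.exists_isState hI hτ.1
    refine ⟨⟨φ, hφ.isPureState_of_isPureStateOfIdeal hI hτ, ?_⟩, rfl⟩
    by_contra! h0
    have : φ.comp I.subtypeL = 0 := ContinuousLinearMap.ext fun x => h0 x x.2
    have h1 := hτ.1.2
    rw [this, ContinuousLinearMap.opNorm_zero] at h1
    exact zero_ne_one h1
  let e := Equiv.ofBijective F ⟨hinj, hsurj⟩
  refine ⟨F, hF, (Equiv.isHomeomorph_iff e).2 ⟨?_, ?_⟩⟩
  · refine Continuous.subtype_mk (WeakDual.continuous_of_continuous_eval fun x => ?_) _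
    exact (WeakDual.eval_continuous (x : A)).comp continuous_subtype_val
  · refine Continuous.subtype_mk (WeakDual.continuous_of_continuous_eval fun a => ?_) _
    have hev : ∀ τ, ∀ x, ∀ hx : x ∈ I, (e.symm τ).1 x = τ.1 ⟨x, hx⟩ := fun τ x hx =>
      congr(($(e.apply_symm_apply τ)).1 ⟨x, hx⟩)
    have hcont : ∀ x ∈ I, Continuous fun τ => (e.symm τ).1 x := fun x hx => by
      simp only [hev _ x hx]
      exact (WeakDual.eval_continuous (⟨x, hx⟩ : I)).comp continuous_subtype_val
    refine continuous_iff_continuousAt.2 fun τ₀ => Metric.tendsto_nhds.2 fun ε hε => ?_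
    set η : ℝ := ε / (4 * (‖a‖ + 1)) with hη
    have hη0 : 0 < η := by positivity
    have hηa : η * (4 * (‖a‖ + 1)) = ε := div_mul_cancel₀ _ (by positivity)
    have hsI : IsStateOfIdeal I (ContinuousLinearMap.comp (e.symm τ₀).1 I.subtypeL) :=
      (F (e.symm τ₀)).2.1
    obtain ⟨c, hc, hc1, hcη⟩ := exists_lt_re_apply_star_mul_self hI hsI
      (show 0 < η ^ 2 by positivity)
    have hp : star c * c ∈ I := hI.2.1 _ _ hc
    have hap : a * (star c * c) ∈ I := hI.2.1 _ _ hp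
    have hsqrt : ∀ {u : ℝ}, 1 - η ^ 2 < u → √(1 - u) ≤ η := fun h =>
      Real.sqrt_le_iff.2 ⟨hη0.le, by linarith⟩
    filter_upwards [(Complex.continuous_re.comp (hcont _ hp)).continuousAt.eventually_const_lt hcη,
      Metric.tendsto_nhds.1 (hcont _ hap).continuousAt (ε / 2) (half_pos hε)] with τ h₁ h₂
    rw [dist_eq_norm] at h₂ ⊢
    have h := IsState.norm_sub_apply_le (e.symm τ).2.1.1 (e.symm τ₀).2.1.1 hc1 a
    refine h.trans_lt ((add_lt_add_of_lt_of_le h₂ (mul_le_mul_of_nonneg_right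
      (add_le_add (hsqrt h₁) (hsqrt hcη)) (norm_nonneg a))).trans_le ?_)
    linarith

end Ideals

/-- For a closed two-sided ideal `I` of a C*-algebra `A`, restriction is a bijection
from the pure states of `A` not vanishing on `I` onto the pure states of `I`, and it is
a homeomorphism for the weak* topologies. -/
theorem pure_states_of_ideal_restriction_homeomorph
    {A : Type*} [NonUnitalNormedRing A] [NormedSpace ℂ A] [StarRing A]
    [CStarRing A] [CompleteSpace A] [IsScalarTower ℂ A A] [SMulCommClass ℂ A A]
    [StarModule ℂ A]
    (I : Submodule ℂ A) (hI : IsClosedTwoSidedIdeal I) :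
    ∃ F : {φ : WeakDual ℂ A // IsPureState A φ ∧ ∃ x ∈ I, φ x ≠ 0} →
          {τ : WeakDual ℂ ↥I // IsPureStateOfIdeal I τ},
      -- `F φ` is the restriction of `φ` to `I`
      (∀ φ, ∀ x : ↥I, (F φ).1 x = φ.1 (x : A)) ∧
      -- `F` is a bijection, continuous with continuous inverse (weak* topologies)
      IsHomeomorph F := by
  let _ : NonUnitalCStarAlgebra A := {}
  exact exists_isHomeomorph_restrict I hI
end
end

section
/- Let H be a complex Hilbert space and let K(H) denote the C*-algebra of compact operators on H. A subset B ⊆ K(H) is a hereditary C*-subalgebra of K(H) if and only if there exists a closed subspace M of H such that B = {T ∈ K(H) : P_M T P_M = T}, where P_M is the orthogonal projection of H onto M; this set is *-isomorphic to the algebra K(M) of compact operators on M. -/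
open scoped InnerProductSpace

noncomputable section

variable {H : Type*} [NormedAddCommGroup H] [InnerProductSpace ℂ H] [CompleteSpace H]

/-- `B` is a hereditary C*-subalgebra of the C*-algebra `K(H)` of compact operators:
it is a norm-closed *-subalgebra consisting of compact operators such that any compact
operator `S` with `0 ≤ S ≤ T` for some `T ∈ B` belongs to `B` (`≤` being the Loewner
order). -/
def IsHereditaryInCompacts (B : Set (H →L[ℂ] H)) : Prop :=
  (∀ T ∈ B, IsCompactOperator T) ∧
  IsClosed B ∧
  (0 : H →L[ℂ] H) ∈ B ∧
  (∀ S ∈ B, ∀ T ∈ B, S + T ∈ B) ∧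
  (∀ c : ℂ, ∀ T ∈ B, c • T ∈ B) ∧
  (∀ S ∈ B, ∀ T ∈ B, S * T ∈ B) ∧
  (∀ T ∈ B, star T ∈ B) ∧
  (∀ S T : H →L[ℂ] H, IsCompactOperator S → T ∈ B → 0 ≤ S → S ≤ T → S ∈ B)

/-- `P` is the orthogonal projection of `H` onto the closed subspace `M`. -/
def IsOrthProjOnto (M : Submodule ℂ H) (P : H →L[ℂ] H) : Prop :=
  (∀ v : H, P v ∈ M) ∧ (∀ v ∈ M, P v = v) ∧ ∀ v : H, ∀ y ∈ M, ⟪v - P v, y⟫_ℂ = 0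

open InnerProductSpace ContinuousLinearMap

set_option linter.unusedSectionVars false

/-- A compact operator is approximated in norm by its compressions onto finite-dimensional
subspaces of its range. -/
lemma IsCompactOperator.exists_norm_sub_starProjection_comp_le {T : H →L[ℂ] H}
    (hT : IsCompactOperator T) {ε : ℝ} (hε : 0 < ε) :
    ∃ U : Submodule ℂ H, ∃ _ : FiniteDimensional ℂ U, (U : Set H) ⊆ Set.range T ∧
      ‖T - U.starProjection * T‖ ≤ ε := by
  have htb : TotallyBounded (T '' Metric.closedBall 0 1) := by
    have h := hT.isCompact_closure_image_closedBall (f := (T : H →ₗ[ℂ] H)) 1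
    exact h.totallyBounded.subset subset_closure
  obtain ⟨t, hts, htf, hcov⟩ := Metric.finite_approx_of_totallyBounded htb ε hε
  have hfd : FiniteDimensional ℂ (Submodule.span ℂ t) := FiniteDimensional.span_of_finite ℂ htf
  refine ⟨Submodule.span ℂ t, hfd, ?_, ?_⟩
  · have : Submodule.span ℂ t ≤ (T : H →ₗ[ℂ] H).range := by
      refine Submodule.span_le.2 fun y hy => ?_
      obtain ⟨x, -, rfl⟩ := hts hy
      exact ⟨x, rfl⟩
    intro y hy
    obtain ⟨x, hx⟩ := this hy
    exact ⟨x, hx⟩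
  · refine opNorm_le_of_unit_norm hε.le fun x hx => ?_
    have hmem : T x ∈ ⋃ y ∈ t, Metric.ball y ε :=
      hcov ⟨x, by simp [hx], rfl⟩
    simp only [Set.mem_iUnion] at hmem
    obtain ⟨y, hy, hxy⟩ := hmem
    have h1 := Submodule.starProjection_minimal (U := Submodule.span ℂ t) (T x)
    have h2 : (⨅ z : Submodule.span ℂ t, ‖T x - z‖) ≤ ‖T x - y‖ :=
      ciInf_le (f := fun z : Submodule.span ℂ t => ‖T x - z‖)
        ⟨0, by rintro _ ⟨z, rfl⟩; positivity⟩ ⟨y, Submodule.subset_span hy⟩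
    have h3 : ‖T x - y‖ < ε := by rwa [← dist_eq_norm]
    change ‖T x - (Submodule.span ℂ t).starProjection (T x)‖ ≤ ε
    linarith

lemma isCompactOperator_starProjection (U : Submodule ℂ H) [FiniteDimensional ℂ U] :
    IsCompactOperator U.starProjection :=
  (isCompactOperator_of_locallyCompactSpace_dom U.orthogonalProjectionOnto).clm_comp U.subtypeL

lemma isCompactOperator_rankOne (x y : H) : IsCompactOperator (rankOne ℂ x y) := by
  rw [rankOne_def']
  exact (isCompactOperator_of_locallyCompactSpace_rng (toSpanSingleton ℂ x)).comp_clm (innerSL ℂ y)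

/-- The adjoint of a compact operator on a Hilbert space is compact. -/
lemma IsCompactOperator.star {T : H →L[ℂ] H} (hT : IsCompactOperator T) :
    IsCompactOperator (star T : H →L[ℂ] H) := by
  have hcl : IsClosed {S : H →L[ℂ] H | IsCompactOperator S} := isClosed_setOfPred_isCompactOperator
  refine hcl.closure_subset (Metric.mem_closure_iff.2 fun ε hε => ?_)
  obtain ⟨U, _, -, hU⟩ := hT.exists_norm_sub_starProjection_comp_le (half_pos hε)
  refine ⟨Star.star T * U.starProjection,
    (isCompactOperator_starProjection U).clm_comp (Star.star T), ?_⟩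
  have hs : Star.star T * U.starProjection = Star.star (U.starProjection * T) := by
    rw [star_mul, (isSelfAdjoint_starProjection U).star_eq]
  rw [dist_eq_norm, hs, ← star_sub, norm_star]
  linarith

lemma rankOne_apply_self_le (T : H →L[ℂ] H) (x : H) :
    rankOne ℂ (T x) (T x) ≤ ((‖x‖ ^ 2 : ℝ) : ℂ) • (T * star T) := by
  have hpos : (((‖x‖ ^ 2 : ℝ) : ℂ) • (1 : H →L[ℂ] H) - rankOne ℂ x x).IsPositive := by
    rw [isPositive_iff_complex]
    intro v
    have : ⟪(((‖x‖ ^ 2 : ℝ) : ℂ) • (1 : H →L[ℂ] H) - rankOne ℂ x x) v, v⟫_ℂ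
        = ((‖x‖ ^ 2 * ‖v‖ ^ 2 - ‖⟪x, v⟫_ℂ‖ ^ 2 : ℝ) : ℂ) := by
      simp only [sub_apply, smul_apply, one_apply_eq_self, rankOne_apply,
        inner_sub_left, inner_smul_left, Complex.conj_ofReal, inner_self_eq_norm_sq_to_K,
        RCLike.conj_mul]
      push_cast
      rfl
    rw [this]
    simp only [RCLike.re_eq_complex_re, Complex.ofReal_re, true_and]
    have h := norm_inner_le_norm (𝕜 := ℂ) x v
    have h2 := pow_le_pow_left₀ (norm_nonneg _) h 2
    rw [mul_pow] at h2
    exact sub_nonneg.2 h2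
  rw [ContinuousLinearMap.le_def]
  convert hpos.conj_adjoint T using 1
  ext v
  simp [star_eq_adjoint, adjoint_inner_right]

namespace IsHereditaryInCompacts

variable {B : Set (H →L[ℂ] H)}

lemma rankOne_apply_self_mem (hB : IsHereditaryInCompacts B) {T : H →L[ℂ] H} (hT : T ∈ B)
    (x : H) : rankOne ℂ (T x) (T x) ∈ B := by
  obtain ⟨-, -, -, -, hsmul, hmul, hstar, hher⟩ := hB
  exact hher _ _ (isCompactOperator_rankOne _ _) (hsmul _ _ (hmul _ hT _ (hstar _ hT)))
    ((nonneg_iff_isPositive _).2 (isPositive_rankOne_self _)) (rankOne_apply_self_le T x)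

/-- The closed subspace of vectors `x` whose rank one operator `⟪x, ·⟫ x` lies in `B`. -/
def support (hB : IsHereditaryInCompacts B) : Submodule ℂ H where
  carrier := {x | rankOne ℂ x x ∈ B}
  zero_mem' := by simpa using hB.2.2.1
  add_mem' {x y} hx hy := by
    obtain ⟨-, -, -, hadd, hsmul, -, -, hher⟩ := hB
    refine hher _ _ (isCompactOperator_rankOne _ _)
      (hsmul 2 _ (hadd _ hx _ hy)) ((nonneg_iff_isPositive _).2 (isPositive_rankOne_self _)) ?_
    rw [ContinuousLinearMap.le_def]
    convert isPositive_rankOne_self (𝕜 := ℂ) (x - y) using 1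
    ext v
    simp only [sub_apply, smul_apply, add_apply, rankOne_apply, inner_add_left, inner_sub_left]
    module
  smul_mem' c x hx := by
    have h := hB.2.2.2.2.1 (c * starRingEnd ℂ c) _ hx
    change rankOne ℂ (c • x) (c • x) ∈ B
    convert h using 1
    ext v
    simp only [smul_apply, rankOne_apply, inner_smul_left]
    module

lemma mem_support (hB : IsHereditaryInCompacts B) {x : H} :
    x ∈ hB.support ↔ rankOne ℂ x x ∈ B := Iff.rfl

lemma isClosed_support (hB : IsHereditaryInCompacts B) : IsClosed (hB.support : Set H) :=
  hB.2.1.preimage (f := fun x : H => rankOne ℂ x x)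
    ((smulRightL ℂ H H).continuous₂.comp ((innerSL ℂ).continuous.prodMk continuous_id))

lemma rankOne_mem (hB : IsHereditaryInCompacts B) {x y : H} (hx : x ∈ hB.support)
    (hy : y ∈ hB.support) : rankOne ℂ x y ∈ B := by
  have key (c : ℂ) : rankOne ℂ (x + c • y) (x + c • y) ∈ B :=
    hB.mem_support.1 (add_mem hx (Submodule.smul_mem _ c hy))
  obtain ⟨-, -, -, hadd, hsmul, -, -, -⟩ := hB
  have h := hsmul (1 / 4) _ (hadd _ (hadd _ (key 1) _ (hsmul (-1) _ (key (-1))))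
    _ (hadd _ (hsmul Complex.I _ (key Complex.I)) _ (hsmul (-Complex.I) _ (key (-Complex.I)))))
  convert h using 1
  ext v
  simp only [smul_apply, add_apply, rankOne_apply, inner_add_left, inner_smul_left, map_neg,
    map_one, Complex.conj_I]
  match_scalars <;> ring_nf <;> norm_num [Complex.I_sq]
  ring

/-- A hereditary subalgebra contains every compact operator which, together with its adjoint,
takes values in the support. -/
lemma mem_of_apply_mem_support (hB : IsHereditaryInCompacts B) {T : H →L[ℂ] H}
    (hT : IsCompactOperator T) (hr : ∀ x, T x ∈ hB.support)
    (hr' : ∀ x, star T x ∈ hB.support) : T ∈ B := by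
  refine hB.2.1.closure_subset (Metric.mem_closure_iff.2 fun ε hε => ?_)
  obtain ⟨U, _, hUr, hU⟩ := hT.exists_norm_sub_starProjection_comp_le (half_pos hε)
  refine ⟨U.starProjection * T, ?_, by rw [dist_eq_norm]; linarith⟩
  let b := stdOrthonormalBasis ℂ U
  have hsum : U.starProjection * T = ∑ i, rankOne ℂ (b i : H) (star T (b i : H)) := by
    ext v
    simp [b.starProjection_eq_sum_rankOne, star_eq_adjoint, adjoint_inner_left]
  rw [hsum]
  refine Finset.sum_induction _ (· ∈ B) (fun S R hS hR => hB.2.2.2.1 S hS R hR) hB.2.2.1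
    fun i _ => hB.rankOne_mem ?_ (hr' _)
  obtain ⟨x, hx⟩ := hUr (b i).2
  exact hx ▸ hr x

end IsHereditaryInCompacts

namespace IsOrthProjOnto

variable {M : Submodule ℂ H} {P : H →L[ℂ] H}

lemma isSelfAdjoint (hP : IsOrthProjOnto M P) : IsSelfAdjoint P := by
  rw [isSelfAdjoint_iff_isSymmetric]
  intro x y
  have h1 := hP.2.2 x (P y) (hP.1 y)
  have h2 := hP.2.2 y (P x) (hP.1 x)
  rw [inner_sub_left, sub_eq_zero] at h1 h2
  have h3 := congrArg (starRingEnd ℂ) h2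
  simp only [inner_conj_symm] at h3
  exact h3.trans h1.symm

lemma mul_self (hP : IsOrthProjOnto M P) : P * P = P := by
  ext v
  exact hP.2.1 _ (hP.1 v)

lemma mul_left_eq (hP : IsOrthProjOnto M P) {T : H →L[ℂ] H} (hT : P * T * P = T) : P * T = T := by
  rw [← hT, ← mul_assoc, ← mul_assoc, hP.mul_self]

lemma mul_right_eq (hP : IsOrthProjOnto M P) {T : H →L[ℂ] H} (hT : P * T * P = T) :
    T * P = T := by
  rw [← hT, mul_assoc, hP.mul_self]

lemma star_corner (hP : IsOrthProjOnto M P) {T : H →L[ℂ] H} (hT : P * T * P = T) :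
    P * star T * P = star T := by
  conv_rhs => rw [← hT]
  simp [hP.isSelfAdjoint.star_eq, mul_assoc]

/-- A positive operator dominated by an element of a corner lies in the corner. -/
lemma corner_of_le (hP : IsOrthProjOnto M P) {S T : H →L[ℂ] H} (hT : P * T * P = T)
    (hS : 0 ≤ S) (hST : S ≤ T) : P * S * P = S := by
  have hsa := hP.isSelfAdjoint.star_eq
  obtain ⟨R, rfl⟩ := CStarAlgebra.nonneg_iff_eq_star_mul_self.1 hS
  have h0 : star (1 - P) * T * (1 - P) = 0 := by
    rw [mul_assoc, mul_sub, mul_one, hP.mul_right_eq hT, sub_self, mul_zero]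
  have h1 := star_left_conjugate_le_conjugate hST (1 - P)
  have h2 := star_left_conjugate_nonneg hS (1 - P)
  have h3 : star (R * (1 - P)) * (R * (1 - P)) = 0 := by
    rw [star_mul]
    simpa only [mul_assoc] using le_antisymm (h1.trans_eq h0) h2
  have h4 : R * P = R := by
    have := CStarRing.star_mul_self_eq_zero_iff _ |>.1 h3
    rw [mul_sub, mul_one, sub_eq_zero] at this
    exact this.symm
  have h5 : P * star R = star R := by simpa [hsa] using congrArg star h4
  rw [← mul_assoc, h5, mul_assoc, h4]

lemma isHereditaryInCompacts (hP : IsOrthProjOnto M P) :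
    IsHereditaryInCompacts {T : H →L[ℂ] H | IsCompactOperator T ∧ P * T * P = T} := by
  refine ⟨fun T hT => hT.1, ?_, ?_, ?_, ?_, ?_, ?_, ?_⟩
  · exact isClosed_setOfPred_isCompactOperator.inter
      (isClosed_eq (by fun_prop) continuous_id)
  · exact ⟨(compactOperator (RingHom.id ℂ) H H).zero_mem, by simp⟩
  · exact fun S hS T hT => ⟨hS.1.add hT.1, by rw [mul_add, add_mul, hS.2, hT.2]⟩
  · exact fun c T hT => ⟨hT.1.smul c, by rw [mul_smul_comm, smul_mul_assoc, hT.2]⟩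
  · exact fun S hS T hT => ⟨hS.1.comp_clm T, by
      rw [← mul_assoc, hP.mul_left_eq hS.2, mul_assoc, hP.mul_right_eq hT.2]⟩
  · exact fun T hT => ⟨hT.1.star, hP.star_corner hT.2⟩
  · exact fun S T hSc hT hS hST => ⟨hSc, hP.corner_of_le hT.2 hS hST⟩

end IsOrthProjOnto

lemma IsHereditaryInCompacts.exists_eq_corner {B : Set (H →L[ℂ] H)}
    (hB : IsHereditaryInCompacts B) :
    ∃ M : Submodule ℂ H, IsClosed (M : Set H) ∧
      ∃ P : H →L[ℂ] H, IsOrthProjOnto M P ∧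
        B = {T : H →L[ℂ] H | IsCompactOperator T ∧ P * T * P = T} := by
  have : CompleteSpace hB.support := hB.isClosed_support.completeSpace_coe
  have hP : IsOrthProjOnto hB.support hB.support.starProjection :=
    ⟨Submodule.starProjection_apply_mem _, fun v => Submodule.starProjection_eq_self_iff.2,
      fun v y hy => Submodule.starProjection_inner_eq_zero v y hy⟩
  refine ⟨hB.support, hB.isClosed_support, _, hP, Set.ext fun T => ⟨fun hT => ⟨hB.1 T hT, ?_⟩,
    fun hT => hB.mem_of_apply_mem_support hT.1 (fun x => ?_) fun x => ?_⟩⟩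
  · have left_eq {S : H →L[ℂ] H} (hS : S ∈ B) : hB.support.starProjection * S = S := by
      ext v
      exact hP.2.1 _ (hB.rankOne_apply_self_mem hS v)
    have h := congrArg star (left_eq (hB.2.2.2.2.2.2.1 T hT))
    rw [star_mul, star_star, hP.isSelfAdjoint.star_eq] at h
    rw [left_eq hT, h]
  · rw [← hP.mul_left_eq hT.2]
    exact hP.1 _
  · rw [← hP.mul_left_eq (hP.star_corner hT.2)]
    exact hP.1 _

/-- The corner of `K(H)` cut out by the orthogonal projection onto a closed subspace `M` is
identified with `K(M)` by restriction. -/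
def IsOrthProjOnto.cornerEquiv {M : Submodule ℂ H} {P : H →L[ℂ] H} (hP : IsOrthProjOnto M P) :
    {T : H →L[ℂ] H // IsCompactOperator T ∧ P * T * P = T} ≃
      {T : ↥M →L[ℂ] ↥M // IsCompactOperator T} where
  toFun T := ⟨P.codRestrict M hP.1 ∘L T.1 ∘L M.subtypeL,
    (T.2.1.comp_clm M.subtypeL).clm_comp (P.codRestrict M hP.1)⟩
  invFun S := ⟨M.subtypeL ∘L S.1 ∘L P.codRestrict M hP.1,
    (S.2.comp_clm (P.codRestrict M hP.1)).clm_comp M.subtypeL, by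
      ext v
      have h : P.codRestrict M hP.1 (P v) = P.codRestrict M hP.1 v :=
        Subtype.ext (hP.2.1 _ (hP.1 v))
      change P (S.1 (P.codRestrict M hP.1 (P v)) : H) = _
      rw [hP.2.1 _ (Subtype.prop _), h]
      rfl⟩
  left_inv T := Subtype.ext T.2.2
  right_inv S := by
    ext v
    have h : P.codRestrict M hP.1 v = v := Subtype.ext (hP.2.1 _ v.2)
    change P (S.1 (P.codRestrict M hP.1 v) : H) = _
    rw [hP.2.1 _ (Subtype.prop _), h]

lemma IsOrthProjOnto.coe_cornerEquiv_apply {M : Submodule ℂ H} {P : H →L[ℂ] H}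
    (hP : IsOrthProjOnto M P) (T : {T : H →L[ℂ] H // IsCompactOperator T ∧ P * T * P = T})
    (x : M) : ((hP.cornerEquiv T).1 x : H) = T.1 x :=
  congrArg (fun S : H →L[ℂ] H => S x) (hP.mul_left_eq T.2.2)

/-- Hereditary C*-subalgebras of `K(H)` are exactly the corners
`{T ∈ K(H) : P_M T P_M = T}` by orthogonal projections onto closed subspaces `M`, and
every such corner is *-isomorphic to `K(M)`. -/
theorem hereditary_subalgebras_of_compact_operators
    (B : Set (H →L[ℂ] H)) :
    (IsHereditaryInCompacts B ↔
      ∃ M : Submodule ℂ H, IsClosed (M : Set H) ∧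
        ∃ P : H →L[ℂ] H, IsOrthProjOnto M P ∧
          B = {T : H →L[ℂ] H | IsCompactOperator T ∧ P * T * P = T}) ∧
    -- every such corner is *-isomorphic to the compact operators on `M`
    (∀ (M : Submodule ℂ H), IsClosed (M : Set H) →
      ∀ P : H →L[ℂ] H, IsOrthProjOnto M P →
        ∃ e : {T : H →L[ℂ] H // IsCompactOperator T ∧ P * T * P = T} ≃
              {T : ↥M →L[ℂ] ↥M // IsCompactOperator T},
          -- additive
          (∀ T S R, R.1 = T.1 + S.1 → (e R).1 = (e T).1 + (e S).1) ∧
          -- ℂ-homogeneous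
          (∀ (c : ℂ) T S, S.1 = c • T.1 → (e S).1 = c • (e T).1) ∧
          -- multiplicative
          (∀ T S R, R.1 = T.1 * S.1 → (e R).1 = (e T).1 * (e S).1) ∧
          -- star-preserving (the adjoint being characterised via the inner product)
          (∀ T S, S.1 = star T.1 →
            ∀ x y : ↥M, ⟪(e S).1 x, y⟫_ℂ = ⟪x, (e T).1 y⟫_ℂ)) := by
  refine ⟨⟨fun hB => hB.exists_eq_corner, ?_⟩, fun M _ P hP => ⟨hP.cornerEquiv, ?_, ?_, ?_, ?_⟩⟩
  · rintro ⟨M, -, P, hP, rfl⟩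
    exact hP.isHereditaryInCompacts
  · intro T S R h
    ext x
    simp [hP.coe_cornerEquiv_apply, h]
  · intro c T S h
    ext x
    simp [hP.coe_cornerEquiv_apply, h]
  · intro T S R h
    ext x
    simp [hP.coe_cornerEquiv_apply, h]
  · intro T S h x y
    rw [Submodule.coe_inner, Submodule.coe_inner, hP.coe_cornerEquiv_apply,
      hP.coe_cornerEquiv_apply, h, star_eq_adjoint, adjoint_inner_left]
end
end
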